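/- Let Y be a type and C₁, C₂, C₃ : Set (Set Y) collections of subsets of Y. The lifted intersection operation is associative: ⋃ C'' ∈ merge C₁ C₂, merge C'' C₃ = ⋃ C'' ∈ merge C₂ C₃, merge C₁ C''. Moreover both sides equal {C' : Set (Set Y) | ⋃₀ C' = ⋃₀ C₁ ∪ ⋃₀ C₂ ∪ ⋃₀ C₃ ∧ proj C' (dom C₁) ⊆ C₁ ∧ proj C' (dom C₂) ⊆ C₂ ∧ proj C' (dom C₃) ⊆ C₃}. -/

import Mathlib

/-- The domain of a collection of subsets. -/
def dom {Y : Type*} (C : Set (Set Y)) : Set Y := ⋃₀ C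

/-- The projection of a collection of subsets on a domain `D`. -/
def proj {Y : Type*} (C : Set (Set Y)) (D : Set Y) : Set (Set Y) :=
  (fun G => G ∩ D) '' C

/-- The intersection (merge) of two collections of subsets. -/
def merge {Y : Type*} (C₁ C₂ : Set (Set Y)) : Set (Set (Set Y)) :=
  {C' : Set (Set Y) | dom C' = dom C₁ ∪ dom C₂ ∧
    proj C' (dom C₁) ⊆ C₁ ∧ proj C' (dom C₂) ⊆ C₂}

theorem merge_comm_aux {Y : Type*} (C₁ C₂ : Set (Set Y)) : merge C₁ C₂ = merge C₂ C₁ := by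
  ext C'
  simp only [merge, Set.mem_setOf_eq, Set.union_comm (dom C₁)]
  tauto

theorem dom_proj_aux {Y : Type*} (C : Set (Set Y)) (D : Set Y) :
    dom (proj C D) = dom C ∩ D := by
  ext x
  simp only [dom, proj, Set.mem_sUnion, Set.mem_image, Set.mem_inter_iff]
  constructor
  · rintro ⟨_, ⟨G, hG, rfl⟩, hx⟩
    exact ⟨⟨G, hG, hx.1⟩, hx.2⟩
  · rintro ⟨⟨G, hG, hx⟩, hD⟩
    exact ⟨_, ⟨G, hG, rfl⟩, hx, hD⟩

theorem proj_proj_aux {Y : Type*} (C : Set (Set Y)) {D E : Set Y} (h : E ⊆ D) :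
    proj (proj C D) E = proj C E := by
  simp only [proj, Set.image_image, Set.inter_assoc, Set.inter_eq_self_of_subset_right h]

theorem proj_mono_aux {Y : Type*} {C C' : Set (Set Y)} (D : Set Y) (h : C ⊆ C') :
    proj C D ⊆ proj C' D := Set.image_mono h

theorem merge_left_aux {Y : Type*} (C₁ C₂ C₃ : Set (Set Y)) :
    (⋃ C'' ∈ merge C₁ C₂, merge C'' C₃) =
      {C' : Set (Set Y) | dom C' = dom C₁ ∪ dom C₂ ∪ dom C₃ ∧
        proj C' (dom C₁) ⊆ C₁ ∧ proj C' (dom C₂) ⊆ C₂ ∧ proj C' (dom C₃) ⊆ C₃} := by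
  ext C'
  simp only [Set.mem_iUnion, exists_prop, Set.mem_setOf_eq]
  constructor
  · rintro ⟨C, ⟨hd, h1, h2⟩, hd', h, h3⟩
    refine ⟨by rw [hd', hd], ?_, ?_, h3⟩
    · rw [← proj_proj_aux C' (D := dom C) (by rw [hd]; exact Set.subset_union_left)]
      exact (proj_mono_aux _ h).trans h1
    · rw [← proj_proj_aux C' (D := dom C) (by rw [hd]; exact Set.subset_union_right)]
      exact (proj_mono_aux _ h).trans h2
  · rintro ⟨hd, h1, h2, h3⟩
    have hD : dom (proj C' (dom C₁ ∪ dom C₂)) = dom C₁ ∪ dom C₂ := by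
      rw [dom_proj_aux, hd]
      exact Set.inter_eq_self_of_subset_right Set.subset_union_left
    refine ⟨proj C' (dom C₁ ∪ dom C₂), ⟨hD, ?_, ?_⟩, ?_, ?_, h3⟩
    · rwa [proj_proj_aux C' Set.subset_union_left]
    · rwa [proj_proj_aux C' Set.subset_union_right]
    · rw [hD, hd]
    · rw [hD]

/-- The lifted merge operation is associative, and both sides admit an explicit
description. -/
theorem merge_assoc {Y : Type*} (C₁ C₂ C₃ : Set (Set Y)) :
    (⋃ C'' ∈ merge C₁ C₂, merge C'' C₃) = (⋃ C'' ∈ merge C₂ C₃, merge C₁ C'') ∧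
    (⋃ C'' ∈ merge C₁ C₂, merge C'' C₃) =
      {C' : Set (Set Y) | ⋃₀ C' = ⋃₀ C₁ ∪ ⋃₀ C₂ ∪ ⋃₀ C₃ ∧
        proj C' (dom C₁) ⊆ C₁ ∧ proj C' (dom C₂) ⊆ C₂ ∧ proj C' (dom C₃) ⊆ C₃} := by
  refine ⟨?_, merge_left_aux C₁ C₂ C₃⟩
  have r : (⋃ C'' ∈ merge C₂ C₃, merge C₁ C'') = ⋃ C'' ∈ merge C₂ C₃, merge C'' C₁ :=
    Set.iUnion₂_congr fun C'' _ => merge_comm_aux C₁ C''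
  rw [r, merge_left_aux C₂ C₃ C₁, merge_left_aux C₁ C₂ C₃]
  ext C'
  have e : dom C₁ ∪ dom C₂ ∪ dom C₃ = dom C₂ ∪ dom C₃ ∪ dom C₁ := by
    rw [Set.union_assoc, Set.union_comm]
  simp only [Set.mem_setOf_eq, e]
  tauto
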